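/- Assume q ≥ m and let α ∈ Z^m with ℓ(D_α) > 0. If β ∈ T_α, then ⌊D_β⌋_Q = ⌊D_α⌋_Q. -/

import Mathlib

open scoped Classical

/-- Abstract divisor-theoretic data of a nonsingular, projective, geometrically
irreducible algebraic curve over a field `Fq`: a function field `K`, a set of
closed points with their degrees, a genus, and the normalized discrete
valuations of `K` at the closed points (with the junk convention `v P 0 = 0`). -/
structure Curve (Fq : Type) [Field Fq] where
  /-- the function field of the curve -/
  K : Type
  [fieldK : Field K]
  [algebraK : Algebra Fq K]
  /-- the closed points of the curve -/
  Point : Type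
  /-- the degree of a closed point -/
  deg : Point → ℕ
  deg_pos : ∀ P, 0 < deg P
  /-- the genus of the curve -/
  genus : ℕ
  /-- the normalized discrete valuation at a closed point -/
  v : Point → K → ℤ
  v_zero : ∀ P, v P 0 = 0
  v_mul : ∀ (P : Point) {x y : K}, x ≠ 0 → y ≠ 0 → v P (x * y) = v P x + v P y
  v_min_le_add : ∀ (P : Point) {x y : K}, x ≠ 0 → y ≠ 0 → x + y ≠ 0 →
    min (v P x) (v P y) ≤ v P (x + y)
  v_algebraMap : ∀ (P : Point) (c : Fq), c ≠ 0 → v P (algebraMap Fq K c) = 0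
  v_surjective : ∀ P : Point, ∃ x : K, x ≠ 0 ∧ v P x = 1
  /-- a nonzero function has only finitely many zeros and poles -/
  support_finite : ∀ {x : K}, x ≠ 0 → {P : Point | v P x ≠ 0}.Finite
  /-- a function without poles is constant (the curve is projective and
  geometrically irreducible) -/
  no_pole_constant : ∀ {x : K}, x ≠ 0 → (∀ P, 0 ≤ v P x) → ∃ c : Fq, x = algebraMap Fq K c
  /-- principal divisors have degree zero -/
  degree_principal : ∀ {x : K}, x ≠ 0 → ∑ᶠ P : Point, (deg P : ℤ) * v P x = 0

attribute [instance] Curve.fieldK Curve.algebraK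

namespace Curve

variable {Fq : Type} [Field Fq] [Fintype Fq]

/-- The degree of a divisor. -/
noncomputable def degDiv (C : Curve Fq) (D : C.Point →₀ ℤ) : ℤ :=
  D.sum fun P n => (C.deg P : ℤ) * n

/-- The Riemann–Roch space `L(D)`. -/
def Lset (C : Curve Fq) (D : C.Point →₀ ℤ) : Set C.K :=
  {h | h = 0 ∨ ∀ P : C.Point, 0 ≤ C.v P h + D P}

/-- `ℓ(D)`, the dimension of `L(D)` as an `Fq`-vector space. -/
noncomputable def ell (C : Curve Fq) (D : C.Point →₀ ℤ) : ℕ :=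
  Module.finrank Fq (Submodule.span Fq (C.Lset D))

/-- The divisor `D` is principal. -/
def IsPrincipalDiv (C : Curve Fq) (D : C.Point →₀ ℤ) : Prop :=
  ∃ h : C.K, h ≠ 0 ∧ ∀ P : C.Point, C.v P h = D P

/-- The divisor `D_α = α₁Q₁ + ⋯ + α_mQ_m`. -/
noncomputable def Dt (C : Curve Fq) {m : ℕ} (Q : Fin m → C.Point) (α : Fin m → ℤ) :
    C.Point →₀ ℤ :=
  ∑ i, Finsupp.single (Q i) (α i)

/-- The generalized Weierstrass semigroup `Ĥ(Q)`: the set of tuples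
`(-v_{Q_1}(h), …, -v_{Q_m}(h))` for nonzero `h` having poles only in `{Q_1, …, Q_m}`. -/
def Hhat (C : Curve Fq) {m : ℕ} (Q : Fin m → C.Point) : Set (Fin m → ℤ) :=
  {α | ∃ h : C.K, h ≠ 0 ∧ (∀ P : C.Point, P ∉ Set.range Q → 0 ≤ C.v P h) ∧
    ∀ i, α i = -C.v (Q i) h}

/-- `∇_J(α)`. -/
def nabla (C : Curve Fq) {m : ℕ} (Q : Fin m → C.Point) (J : Set (Fin m))
    (α : Fin m → ℤ) : Set (Fin m → ℤ) :=
  {β | β ∈ C.Hhat Q ∧ (∀ j ∈ J, β j = α j) ∧ ∀ i ∉ J, β i < α i}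

/-- `∇_i^m(α)`. -/
def nablaI (C : Curve Fq) {m : ℕ} (Q : Fin m → C.Point) (i : Fin m) (α : Fin m → ℤ) :
    Set (Fin m → ℤ) :=
  {β | β ∈ C.Hhat Q ∧ β i = α i ∧ ∀ j, j ≠ i → β j ≤ α j}

/-- `Γ̂(Q)`, the set of absolute maximal elements of `Ĥ(Q)`. -/
def Gammahat (C : Curve Fq) {m : ℕ} (Q : Fin m → C.Point) : Set (Fin m → ℤ) :=
  {α | α ∈ C.Hhat Q ∧
    ∀ J : Set (Fin m), J.Nonempty → J ≠ Set.univ → C.nabla Q J α = ∅}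

/-- `Γ̂_Q(α) = {β ∈ Γ̂(Q) : β ≤ α}`. -/
def GammahatLe (C : Curve Fq) {m : ℕ} (Q : Fin m → C.Point) (α : Fin m → ℤ) :
    Set (Fin m → ℤ) :=
  {β | β ∈ C.Gammahat Q ∧ ∀ i, β i ≤ α i}

/-- The divisor `A` is a discrepancy with respect to `P` and `Q'`. -/
def IsDiscrepancy (C : Curve Fq) (A : C.Point →₀ ℤ) (P Q' : C.Point) : Prop :=
  C.Lset A ≠ C.Lset (A - Finsupp.single Q' 1) ∧
  C.Lset (A - Finsupp.single P 1) = C.Lset (A - Finsupp.single P 1 - Finsupp.single Q' 1)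

/-- `T_α = {β ∈ ℤ^m : β ≤ α and ℓ(D_β) = ℓ(D_α)}`. -/
def Tset (C : Curve Fq) {m : ℕ} (Q : Fin m → C.Point) (α : Fin m → ℤ) :
    Set (Fin m → ℤ) :=
  {β | (∀ j, β j ≤ α j) ∧ C.ell (C.Dt Q β) = C.ell (C.Dt Q α)}

/-- `D_β` is the supported floor `⌊D_α⌋_Q`: `β` is the element of `T_α` of minimum
norm `|β| = β₁ + ⋯ + β_m`. -/
def IsSuppFloor (C : Curve Fq) {m : ℕ} (Q : Fin m → C.Point) (α β : Fin m → ℤ) : Prop :=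
  β ∈ C.Tset Q α ∧ ∀ γ ∈ C.Tset Q α, ∑ i, β i ≤ ∑ i, γ i

/-- `G'` is the floor `⌊G⌋` of `G`: among all divisors with the same Riemann–Roch
space as `G`, it has minimum degree. -/
def IsFloorDiv (C : Curve Fq) (G G' : C.Point →₀ ℤ) : Prop :=
  C.Lset G' = C.Lset G ∧
  ∀ G'' : C.Point →₀ ℤ, C.Lset G'' = C.Lset G → C.degDiv G' ≤ C.degDiv G''

end Curve

namespace Curve

/-- The Riemann–Roch space as a subspace of the function field. -/
def rrSubmodule {Fq : Type} [Field Fq] (C : Curve Fq) (D : C.Point →₀ ℤ) :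
    Submodule Fq C.K where
  carrier := C.Lset D
  zero_mem' := Or.inl rfl
  add_mem' := by
    intro x y hx hy
    by_cases hx0 : x = 0
    · simpa [hx0] using hy
    by_cases hy0 : y = 0
    · simpa [hy0] using hx
    by_cases hxy : x + y = 0
    · exact Or.inl hxy
    refine Or.inr fun P => ?_
    have h1 := hx.resolve_left hx0 P
    have h2 := hy.resolve_left hy0 P
    have h3 := C.v_min_le_add P hx0 hy0 hxy
    omega
  smul_mem' := by
    intro c x hx
    by_cases hx0 : x = 0
    · exact Or.inl (by simp [hx0])
    by_cases hc : c = 0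
    · exact Or.inl (by simp [hc])
    refine Or.inr fun P => ?_
    have hc' : algebraMap Fq C.K c ≠ 0 := by simpa using hc
    rw [Algebra.smul_def, C.v_mul P hc' hx0, C.v_algebraMap P c hc, zero_add]
    exact hx.resolve_left hx0 P

theorem coe_rrSubmodule {Fq : Type} [Field Fq] (C : Curve Fq) (D : C.Point →₀ ℤ) :
    (C.rrSubmodule D : Set C.K) = C.Lset D := rfl

theorem ell_eq_finrank {Fq : Type} [Field Fq] (C : Curve Fq) (D : C.Point →₀ ℤ) :
    C.ell D = Module.finrank Fq (C.rrSubmodule D) := by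
  rw [ell, ← coe_rrSubmodule, Submodule.span_eq]

theorem Lset_mono {Fq : Type} [Field Fq] (C : Curve Fq) {D E : C.Point →₀ ℤ} (h : D ≤ E) :
    C.Lset D ⊆ C.Lset E := by
  rintro x (hx | hx)
  · exact Or.inl hx
  · exact Or.inr fun P => (hx P).trans (add_le_add le_rfl (h P))

theorem Lset_eq_of_le_of_ell_eq {Fq : Type} [Field Fq] (C : Curve Fq) {D E : C.Point →₀ ℤ}
    (h : D ≤ E) (hE : 0 < C.ell E) (hDE : C.ell D = C.ell E) : C.Lset D = C.Lset E := by
  rw [ell_eq_finrank] at hE hDE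
  rw [C.ell_eq_finrank E] at hDE
  have := Module.finite_of_finrank_pos hE
  have hle : C.rrSubmodule D ≤ C.rrSubmodule E := C.Lset_mono h
  exact congrArg (fun S : Submodule Fq C.K => (S : Set C.K))
    (Submodule.eq_of_le_of_finrank_eq hle hDE)

theorem Lset_inf {Fq : Type} [Field Fq] (C : Curve Fq) (D E : C.Point →₀ ℤ) :
    C.Lset (D ⊓ E) = C.Lset D ∩ C.Lset E := by
  refine Set.Subset.antisymm
    (Set.subset_inter (C.Lset_mono inf_le_left) (C.Lset_mono inf_le_right)) ?_
  rintro x ⟨hD | hD, hE | hE⟩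
  · exact Or.inl hD
  · exact Or.inl hD
  · exact Or.inl hE
  · refine Or.inr fun P => ?_
    have h1 := hD P
    have h2 := hE P
    rw [Finsupp.inf_apply]
    omega

section Dt

variable {Fq : Type} [Field Fq] (C : Curve Fq) {m : ℕ} {Q : Fin m → C.Point}

theorem Dt_apply (hQ : Function.Injective Q) (α : Fin m → ℤ) (i : Fin m) :
    C.Dt Q α (Q i) = α i := by
  simp [Dt, Finsupp.finsetSum_apply, Finsupp.single_apply, hQ.eq_iff]

theorem Dt_apply_of_notMem (α : Fin m → ℤ) {P : C.Point} (hP : P ∉ Set.range Q) :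
    C.Dt Q α P = 0 := by
  rw [Dt, Finsupp.finsetSum_apply]
  exact Finset.sum_eq_zero fun i _ => Finsupp.single_eq_of_ne fun h => hP ⟨i, h.symm⟩

theorem Dt_mono {α β : Fin m → ℤ} (h : α ≤ β) : C.Dt Q α ≤ C.Dt Q β :=
  Finset.sum_le_sum fun i _ => Finsupp.single_mono (h i)

theorem Dt_inf (hQ : Function.Injective Q) (α β : Fin m → ℤ) :
    C.Dt Q (α ⊓ β) = C.Dt Q α ⊓ C.Dt Q β := by
  ext P
  rw [Finsupp.inf_apply]
  by_cases hP : P ∈ Set.range Q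
  · obtain ⟨i, rfl⟩ := hP
    simp only [C.Dt_apply hQ, Pi.inf_apply]
  · simp only [C.Dt_apply_of_notMem _ hP, inf_idem]

theorem inf_mem_Tset (hQ : Function.Injective Q) {α β γ : Fin m → ℤ}
    (hα : 0 < C.ell (C.Dt Q α)) (hβ : β ∈ C.Tset Q α) (hγ : γ ∈ C.Tset Q α) :
    β ⊓ γ ∈ C.Tset Q α := by
  refine ⟨fun j => inf_le_left.trans (hβ.1 j), ?_⟩
  rw [ell, C.Dt_inf hQ, Lset_inf,
    C.Lset_eq_of_le_of_ell_eq (C.Dt_mono hβ.1) hα hβ.2,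
    C.Lset_eq_of_le_of_ell_eq (C.Dt_mono hγ.1) hα hγ.2, Set.inter_self, ell]

end Dt

end Curve

/-- Lemma 3.5(3): assume `q ≥ m` and `ℓ(D_α) > 0`.  If `β ∈ T_α`,
then `⌊D_β⌋_Q = ⌊D_α⌋_Q`. -/
theorem statement4 {Fq : Type} [Field Fq] [Fintype Fq] (C : Curve Fq)
    (hgenus : 0 < C.genus) (K₀ : C.Point →₀ ℤ)
    (hRR : ∀ D : C.Point →₀ ℤ,
      (C.ell D : ℤ) - C.ell (K₀ - D) = C.degDiv D + 1 - C.genus)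
    {m : ℕ} (hm : 2 ≤ m) (Q : Fin m → C.Point)
    (hQinj : Function.Injective Q) (hQdeg : ∀ i, C.deg (Q i) = 1)
    (hq : m ≤ Fintype.card Fq)
    (α : Fin m → ℤ) (hα : 0 < C.ell (C.Dt Q α)) (β : Fin m → ℤ)
    (hβ : β ∈ C.Tset Q α) :
    ∀ γ : Fin m → ℤ, C.IsSuppFloor Q β γ ↔ C.IsSuppFloor Q α γ := by
  have mem_iff : ∀ δ, δ ∈ C.Tset Q β ↔ δ ≤ β ∧ δ ∈ C.Tset Q α := fun δ =>
    ⟨fun h => ⟨h.1, fun j => (h.1 j).trans (hβ.1 j), h.2.trans hβ.2⟩,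
      fun h => ⟨h.1, h.2.2.trans hβ.2.symm⟩⟩
  have inf_mem : ∀ δ ∈ C.Tset Q α, δ ⊓ β ∈ C.Tset Q α := fun δ hδ =>
    C.inf_mem_Tset hQinj hα hδ hβ
  refine fun γ => ⟨fun ⟨hγ, hmin⟩ => ⟨((mem_iff γ).1 hγ).2, fun δ hδ => ?_⟩,
    fun ⟨hγ, hmin⟩ => ⟨(mem_iff γ).2 ⟨?_, hγ⟩, fun δ hδ => hmin δ ((mem_iff δ).1 hδ).2⟩⟩
  · exact (hmin _ ((mem_iff _).2 ⟨inf_le_right, inf_mem δ hδ⟩)).trans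
      (Finset.sum_le_sum fun i _ => inf_le_left)
  · by_contra hle
    have hlt : γ ⊓ β < γ := inf_lt_left.2 hle
    exact (Fintype.sum_strictMono hlt).not_ge (hmin _ (inf_mem γ hγ))
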